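/- For all reals r > 0, c > 0 and 0 < a < a′, the Gamma distribution with shape a and rate r assigns strictly smaller probability to the interval (c, ∞) than does the Gamma distribution with shape a′ and rate r. Consequently, for each p ∈ (0, 1), the p-th quantile of the chi-square distribution is strictly increasing in the degrees of freedom, so an interval of the form [½χ²_{[2x],α/2}, ½χ²_{[2x],1−α/2}] is strictly shorter than the usual interval [½χ²_{[2x],α/2}, ½χ²_{[2x+2],1−α/2}]. -/

import Mathlib

open MeasureTheory ProbabilityTheory Real

lemma gammaPDFReal_mul_lt_mul {r a a' x y : ℝ} (hr : 0 < r) (ha : 0 < a) (haa' : a < a')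
    (hx : 0 < x) (hxy : x < y) :
    gammaPDFReal a' r x * gammaPDFReal a r y < gammaPDFReal a' r y * gammaPDFReal a r x := by
  have hratio : ∀ z, 0 < z → gammaPDFReal a' r z =
      r ^ a' / Gamma a' / (r ^ a / Gamma a) * z ^ (a' - a) * gammaPDFReal a r z := by
    intro z hz
    have hsplit : z ^ (a' - 1) = z ^ (a' - a) * z ^ (a - 1) := by
      rw [← rpow_add hz]; ring_nf
    have hΓ := (Gamma_pos_of_pos ha).ne'
    have hra := (rpow_pos_of_pos hr a).ne'
    simp only [gammaPDFReal, if_pos hz.le, hsplit]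
    field_simp
  have hy := hx.trans hxy
  have hfx := gammaPDFReal_pos ha hr hx
  have hfy := gammaPDFReal_pos ha hr hy
  have hpow : x ^ (a' - a) < y ^ (a' - a) := rpow_lt_rpow hx.le hxy (sub_pos.2 haa')
  have hconst : 0 < r ^ a' / Gamma a' / (r ^ a / Gamma a) := by
    have := ha.trans haa'
    positivity
  rw [hratio x hx, hratio y hy, mul_assoc _ (gammaPDFReal a r x),
    mul_assoc _ (gammaPDFReal a r y), mul_comm (gammaPDFReal a r y)]
  gcongr

lemma gammaMeasure_lt_of_gammaPDFReal_lt {r a b : ℝ} (hr : 0 < r) (ha : 0 < a)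
    {s : Set ℝ} (hs : MeasurableSet s) (hs0 : volume s ≠ 0)
    (h : ∀ x ∈ s, gammaPDFReal a r x < gammaPDFReal b r x) :
    gammaMeasure a r s < gammaMeasure b r s := by
  have := isProbabilityMeasure_gammaMeasure ha hr
  have hfin := measure_ne_top (gammaMeasure a r) s
  rw [gammaMeasure, withDensity_apply _ hs] at hfin ⊢
  rw [gammaMeasure, withDensity_apply _ hs]
  refine setLIntegral_strict_mono hs hs0 (measurable_gammaPDFReal b r).ennreal_ofReal hfin
    (ae_of_all _ fun x hx => ?_)
  exact (ENNReal.ofReal_lt_ofReal_iff_of_nonneg (gammaPDFReal_nonneg ha hr x)).2 (h x hx)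

lemma gammaMeasure_Iic_of_nonpos (a r : ℝ) {x : ℝ} (hx : x ≤ 0) :
    gammaMeasure a r (Set.Iic x) = 0 := by
  rw [gammaMeasure, withDensity_apply _ measurableSet_Iic, setLIntegral_congr Iio_ae_eq_Iic.symm]
  exact lintegral_gammaPDF_of_nonpos hx

lemma gammaMeasure_Iic_eq_Ioc (a r : ℝ) {x : ℝ} (hx : 0 ≤ x) :
    gammaMeasure a r (Set.Iic x) = gammaMeasure a r (Set.Ioc 0 x) := by
  rw [← Set.Iic_union_Ioc_eq_Iic hx]
  refine le_antisymm ?_ (measure_mono Set.subset_union_right)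
  simpa [gammaMeasure_Iic_of_nonpos a r le_rfl] using
    measure_union_le (μ := gammaMeasure a r) (Set.Iic 0) (Set.Ioc 0 x)

lemma MeasureTheory.measure_compl_lt_measure_compl_iff {α : Type*} [MeasurableSpace α]
    {μ ν : Measure α} [IsProbabilityMeasure μ] [IsProbabilityMeasure ν] {s : Set α}
    (hs : MeasurableSet s) : μ sᶜ < ν sᶜ ↔ ν s < μ s := by
  rw [prob_compl_eq_one_sub hs, prob_compl_eq_one_sub hs]
  rw [← not_le, ← not_le, not_iff_not]
  exact ENNReal.sub_le_sub_iff_left prob_le_one ENNReal.one_ne_top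

lemma gammaMeasure_Ioi_lt {r c a a' : ℝ} (hr : 0 < r) (hc : 0 < c) (ha : 0 < a) (haa' : a < a') :
    gammaMeasure a r (Set.Ioi c) < gammaMeasure a' r (Set.Ioi c) := by
  have ha' := ha.trans haa'
  have := isProbabilityMeasure_gammaMeasure ha hr
  have := isProbabilityMeasure_gammaMeasure ha' hr
  have hfc := gammaPDFReal_pos ha hr hc
  rcases le_or_gt (gammaPDFReal a r c) (gammaPDFReal a' r c) with hle | hlt
  · refine gammaMeasure_lt_of_gammaPDFReal_lt hr ha measurableSet_Ioi (by simp) ?_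
    intro x hx
    have hfx := gammaPDFReal_pos ha hr (hc.trans hx)
    have := gammaPDFReal_mul_lt_mul hr ha haa' hc hx
    nlinarith
  · rw [← Set.compl_Iic, measure_compl_lt_measure_compl_iff measurableSet_Iic,
      gammaMeasure_Iic_eq_Ioc a r hc.le, gammaMeasure_Iic_eq_Ioc a' r hc.le]
    refine gammaMeasure_lt_of_gammaPDFReal_lt hr ha' measurableSet_Ioc (by simpa using hc) ?_
    rintro x ⟨hx, hxc⟩
    rcases hxc.eq_or_lt with rfl | hxc
    · exact hlt
    have hfx := gammaPDFReal_pos ha hr hx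
    have := gammaPDFReal_mul_lt_mul hr ha haa' hx hxc
    nlinarith

lemma gammaMeasure_Iic_lt {r c a a' : ℝ} (hr : 0 < r) (hc : 0 < c) (ha : 0 < a) (haa' : a < a') :
    gammaMeasure a' r (Set.Iic c) < gammaMeasure a r (Set.Iic c) := by
  have := isProbabilityMeasure_gammaMeasure ha hr
  have := isProbabilityMeasure_gammaMeasure (ha.trans haa') hr
  rw [← measure_compl_lt_measure_compl_iff measurableSet_Iic, Set.compl_Iic]
  exact gammaMeasure_Ioi_lt hr hc ha haa'

/-- For r, c > 0 and 0 < a < a′, Gamma(a, r) assigns strictly smaller probability to (c, ∞)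
than Gamma(a′, r); consequently for each p ∈ (0,1) the p-th quantiles are strictly increasing
in the shape (and hence chi-square quantiles strictly increase in the degrees of freedom). -/
theorem gamma_tail_strict_mono (r c : ℝ) (hr : 0 < r) (hc : 0 < c)
    (a a' : ℝ) (ha : 0 < a) (haa' : a < a') :
    gammaMeasure a r (Set.Ioi c) < gammaMeasure a' r (Set.Ioi c) ∧
    ∀ p ∈ Set.Ioo (0:ℝ) 1, ∀ q q' : ℝ,
      gammaMeasure a r (Set.Iic q) = ENNReal.ofReal p →
      gammaMeasure a' r (Set.Iic q') = ENNReal.ofReal p → q < q' := by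
  refine ⟨gammaMeasure_Ioi_lt hr hc ha haa', fun p hp q q' hq hq' => ?_⟩
  have hq'0 : 0 < q' := by
    by_contra! hle
    rw [gammaMeasure_Iic_of_nonpos a' r hle, eq_comm, ENNReal.ofReal_eq_zero] at hq'
    exact hp.1.not_ge hq'
  by_contra! hle
  refine (gammaMeasure_Iic_lt hr hq'0 ha haa').not_ge ?_
  rw [hq', ← hq]
  exact measure_mono (Set.Iic_subset_Iic.2 hle)
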